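/- Let (g,(f_d)_{d=1}^N) and (g',(f'_d)_{d=1}^N) be two ILDs with the same latent dimension m, number of domains N, and observation space X. Then the two ILDs are counterfactually equivalent if and only if there exist bijections h₁, h₂ : ℝ^m → ℝ^m such that g' = g ∘ h₁⁻¹ and f'_d = h₁ ∘ f_d ∘ h₂ for every domain d. -/

import Mathlib

/-- A map `f : ℝ^m → ℝ^m` is autoregressive if each output coordinate depends only on the
input coordinates with index at most its own. -/
def Autoregressive (m : ℕ) (f : (Fin m → ℝ) → Fin m → ℝ) : Prop :=
  ∀ (j : Fin m) (x y : Fin m → ℝ), (∀ i, i ≤ j → x i = y i) → f x j = f y j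

/-- An invertible latent domain causal model (ILD). -/
structure ILD (m N : ℕ) (X : Type*) where
  g : (Fin m → ℝ) ≃ X
  f : Fin N → (Fin m → ℝ) ≃ (Fin m → ℝ)
  hauto : ∀ d, Autoregressive m (f d)

/-- Two ILDs are counterfactually equivalent if all their domain counterfactual maps agree. -/
def CFEquiv {m N : ℕ} {X : Type*} (M M' : ILD m N X) : Prop :=
  ∀ d d' : Fin N,
    (⇑M.g ∘ ⇑(M.f d') ∘ ⇑(M.f d).symm ∘ ⇑M.g.symm : X → X) =
      ⇑M'.g ∘ ⇑(M'.f d') ∘ ⇑(M'.f d).symm ∘ ⇑M'.g.symm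

/-- Characterization of counterfactual equivalence: two ILDs are counterfactually
equivalent iff there exist bijections `h₁, h₂ : ℝ^m → ℝ^m` with `g' = g ∘ h₁⁻¹` and
`f'_d = h₁ ∘ f_d ∘ h₂` for every domain `d`. -/
theorem stmt7 (m N : ℕ) (X : Type*) (M M' : ILD m N X) :
    CFEquiv M M' ↔
      ∃ h₁ h₂ : (Fin m → ℝ) ≃ (Fin m → ℝ),
        ⇑M'.g = ⇑M.g ∘ ⇑h₁.symm ∧ ∀ d, ⇑(M'.f d) = ⇑h₁ ∘ ⇑(M.f d) ∘ ⇑h₂ := by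
  constructor
  · intro h
    rcases Nat.eq_zero_or_pos N with hN | hN
    · subst hN
      exact ⟨M.g.trans M'.g.symm, Equiv.refl _, by funext x; simp, fun d => d.elim0⟩
    · refine ⟨M.g.trans M'.g.symm,
        (M'.f ⟨0, hN⟩).trans ((M'.g.trans M.g.symm).trans (M.f ⟨0, hN⟩).symm),
        by funext x; simp, fun d => ?_⟩
      funext x
      have := congrFun (h ⟨0, hN⟩ d) (M'.g (M'.f ⟨0, hN⟩ x))
      simp only [Function.comp_apply, Equiv.symm_apply_apply] at this
      simp [this]
  · rintro ⟨h₁, h₂, hg, hf⟩ d d'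
    have hg' : M'.g = h₁.symm.trans M.g := by
      ext x; simp [hg]
    have hf' : ∀ d, M'.f d = h₂.trans ((M.f d).trans h₁) := by
      intro d; apply Equiv.ext; intro x; simp [hf]
    funext x
    simp [hg', hf']
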